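/- Let G be an amenable group with a Følner net F = (F_i)_{i∈I}, let X be an algebraic variety over an algebraically closed field K, let A := X(K), and let τ : A^G → A^G be an algebraic cellular automaton over (G,X,K). Suppose Γ ⊆ A^G is such that Γ_Ω is a constructible subset of A^Ω (for the Zariski topology) for every finite subset Ω ⊆ G. Then mdim_F(τ(Γ)) ≤ mdim_F(Γ). -/

import Mathlib

open AlgebraicGeometry CategoryTheory CategoryTheory.Limits Filter Topology
open scoped ENNReal NNReal

noncomputable section

namespace GOE

/-! ## Følner nets and amenability -/

/-- A (right) Følner net for a group `G`: a net of nonempty finite subsets `F i ⊆ G`,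
indexed by a directed nonempty preorder, such that `|F i \ F i g| / |F i| → 0` for every
`g ∈ G`. -/
structure FolnerNet (G : Type) [Group G] where
  ι : Type
  [pre : Preorder ι]
  [ne : Nonempty ι]
  [dir : IsDirected ι (· ≤ ·)]
  F : ι → Finset G
  nonempty : ∀ i, (F i).Nonempty
  folner : ∀ g : G,
    Filter.Tendsto
      (fun i => ((((F i : Set G) \ ((· * g) '' (F i : Set G))).ncard : ℝ) / ((F i).card : ℝ)))
      Filter.atTop (nhds 0)

attribute [instance] FolnerNet.pre FolnerNet.ne FolnerNet.dir

/-- A group is amenable if it admits a Følner net. -/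
def Amenable (G : Type) [Group G] : Prop := Nonempty (FolnerNet G)

/-! ## Constructible subsets of a topological space -/

/-- A subset of a topological space is constructible if it is a finite union of
locally closed subsets. -/
def IsConstr {X : Type} [TopologicalSpace X] (C : Set X) : Prop :=
  ∃ (n : ℕ) (U Z : Fin n → Set X), (∀ i, IsOpen (U i)) ∧ (∀ i, IsClosed (Z i)) ∧
    C = ⋃ i, U i ∩ Z i

/-- Conversion of a Krull dimension (an element of `WithBot ℕ∞`) to an extended real. -/
def dimE (d : WithBot ℕ∞) : EReal :=
  WithBot.recBotCoe ⊥ (fun n : ℕ∞ => ((n : ℝ≥0∞) : EReal)) d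

/-! ## Varieties over a field and their points -/

variable (K : Type) [Field K]

/-- The spectrum of the field `K`, as a scheme. -/
abbrev SpecK : Scheme := Spec (CommRingCat.of K)

/-- The unique point of `Spec K`. -/
def specPt : SpecK K := (⟨⊥, Ideal.bot_prime⟩ : PrimeSpectrum K)

instance : HasFiniteProducts (Over (SpecK K)) :=
  CategoryTheory.Over.ConstructProducts.over_finiteProducts_of_finiteWidePullbacks

/-- The set of `K`-points of a `K`-scheme, i.e. sections of the structure morphism,
i.e. morphisms `Spec K ⟶ X` over `Spec K`. -/
abbrev Pt (W : Over (SpecK K)) : Type := Over.mk (𝟙 (SpecK K)) ⟶ W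

/-- The image in (the underlying space of) `W` of a `K`-point of `W`. -/
def ev {W : Over (SpecK K)} (a : Pt K W) : W.left := a.left.base (specPt K)

/-- The fibered power `X^Ω` over `Spec K` of a `K`-scheme `X`, for a finite index set `Ω`. -/
def pow (V : Over (SpecK K)) (Ω : Type) [Finite Ω] : Over (SpecK K) :=
  ∏ᶜ (fun _ : Ω => V)

/-- The canonical identification of families of `K`-points indexed by `Ω` with
`K`-points of the fibered power `X^Ω`. -/
def ptPow (V : Over (SpecK K)) (Ω : Type) [Finite Ω] (a : Ω → Pt K V) :
    Pt K (pow K V Ω) := Pi.lift a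

variable (V : Over (SpecK K))

/-- The Krull dimension of (the underlying space of) a `K`-scheme. -/
def vdim : WithBot ℕ∞ := topologicalKrullDim V.left

/-- The Zariski topology on `A^Ω` (`A` the set of `K`-points of `X`), induced from the
Zariski topology of the fibered power `X^Ω` via the identification of `A^Ω` with a
subset (the set of closed points, for `K` algebraically closed) of `X^Ω`. -/
def cfgTop (Ω : Type) [Finite Ω] : TopologicalSpace (Ω → Pt K V) :=
  TopologicalSpace.induced (fun u => ev K (ptPow K V Ω u)) inferInstance

/-- The Krull dimension of a subset `D ⊆ A^Ω` for the Zariski topology. -/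
def cfgDim (Ω : Type) [Finite Ω] (D : Set (Ω → Pt K V)) : WithBot ℕ∞ :=
  letI := cfgTop K V Ω
  topologicalKrullDim D

/-- `D ⊆ A^Ω` is closed for the Zariski topology. -/
def cfgClosed (Ω : Type) [Finite Ω] (D : Set (Ω → Pt K V)) : Prop :=
  letI := cfgTop K V Ω
  IsClosed D

/-- `D ⊆ A^Ω` is constructible for the Zariski topology. -/
def cfgConstr (Ω : Type) [Finite Ω] (D : Set (Ω → Pt K V)) : Prop :=
  letI := cfgTop K V Ω
  IsConstr D

/-! ## Configurations, restrictions, cylinders -/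

variable {G : Type} [Group G]

/-- The restriction `Γ_Ω ⊆ A^Ω` of a set of configurations `Γ ⊆ A^G`. -/
def restr (Γ : Set (G → Pt K V)) (Ω : Finset G) : Set (↥Ω → Pt K V) :=
  (fun c (ω : ↥Ω) => c ω) '' Γ

/-- The cylinder `D_p ⊆ A^G`: configurations restricting to an element of `D` on `Ω` and
to `p` on `G ∖ Ω`. -/
def cyl (Ω : Finset G) (D : Set (↥Ω → Pt K V)) (p : {g : G // g ∉ Ω} → Pt K V) :
    Set (G → Pt K V) :=
  {c | (fun ω : ↥Ω => c ω) ∈ D ∧ ∀ (g : G) (h : g ∉ Ω), c g = p ⟨g, h⟩}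

/-- Algebraic mean dimension of `Γ ⊆ A^G` with respect to a Følner net. -/
def mdim (𝓕 : FolnerNet G) (Γ : Set (G → Pt K V)) : EReal :=
  Filter.limsup
    (fun i => dimE (cfgDim K V ↥(𝓕.F i) (restr K V Γ (𝓕.F i))) *
      ((((𝓕.F i).card : ℝ)⁻¹ : ℝ) : EReal))
    Filter.atTop

/-! ## Cellular automata -/

/-- `τ : A^G → A^G` is an algebraic cellular automaton over `(G, X, K)`: it admits a finite
memory set `M ⊆ G` whose associated local defining map `A^M → A` is induced by a morphism
of `K`-schemes `f : X^M → X`. -/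
def IsAlgCA (τ : (G → Pt K V) → (G → Pt K V)) : Prop :=
  ∃ (M : Finset G) (f : pow K V ↥M ⟶ V),
    ∀ (x : G → Pt K V) (g : G),
      τ x g = ptPow K V ↥M (fun m => x (g * (m : G))) ≫ f

/-- Pre-injectivity: configurations that are almost equal and have the same image are equal. -/
def PreInjective (τ : (G → Pt K V) → (G → Pt K V)) : Prop :=
  ∀ c₁ c₂ : G → Pt K V, {g : G | c₁ g ≠ c₂ g}.Finite → τ c₁ = τ c₂ → c₁ = c₂

/-- `(*)`-pre-injectivity: there exist no finite subset `Ω ⊆ G` and Zariski-closed proper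
subset `H ⊊ A^Ω` such that `τ((A^Ω)_p) = τ(H_p)` for all `p ∈ A^{G∖Ω}`. -/
def StarPreInjective (τ : (G → Pt K V) → (G → Pt K V)) : Prop :=
  ¬ ∃ (Ω : Finset G) (H : Set (↥Ω → Pt K V)), cfgClosed K V ↥Ω H ∧ H ≠ Set.univ ∧
      ∀ p : {g : G // g ∉ Ω} → Pt K V,
        τ '' cyl K V Ω Set.univ p = τ '' cyl K V Ω H p

/-- `(**)`-pre-injectivity: there is no finite subset `Ω ⊆ G` such that, for every
`p ∈ A^{G∖Ω}`, the finite-support set `τ((A^Ω)_p)` (written as some `R_s`) satisfies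
`dim(R) < dim(A^Ω)`. -/
def StarStarPreInjective (τ : (G → Pt K V) → (G → Pt K V)) : Prop :=
  ¬ ∃ Ω : Finset G, ∀ p : {g : G // g ∉ Ω} → Pt K V,
      ∃ (Λ : Finset G) (R : Set (↥Λ → Pt K V)) (s : {g : G // g ∉ Λ} → Pt K V),
        τ '' cyl K V Ω Set.univ p = cyl K V Λ R s ∧
        cfgDim K V ↥Λ R < cfgDim K V ↥Ω (Set.univ : Set (↥Ω → Pt K V))

/-- `Γ ⊆ A^G` is closed for the prodiscrete topology on `A^G`. -/
def ProdiscreteClosed {A : Type} (Γ : Set (G → A)) : Prop :=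
  letI : TopologicalSpace A := ⊥
  IsClosed Γ

/-- `Γ ⊆ A^G` is invariant under the shift action of `G`. -/
def ShiftInvariant {A : Type} (Γ : Set (G → A)) : Prop :=
  ∀ (g : G), ∀ c ∈ Γ, (fun h : G => c (g⁻¹ * h)) ∈ Γ

/-- An `(E,E')`-tiling of `G`. -/
def IsTiling (E E' : Finset G) (T : Set G) : Prop :=
  (∀ g ∈ T, ∀ h ∈ T, g ≠ h →
    Disjoint ((g * ·) '' (E : Set G)) ((h * ·) '' (E : Set G))) ∧
  ∀ x : G, ∃ g ∈ T, x ∈ (g * ·) '' (E' : Set G)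


theorem trdeg_quotient_add_one_le {K S : Type} [Field K] [CommRing S] [IsDomain S] [Algebra K S]
    (P : Ideal S) [P.IsPrime] (hP : P ≠ ⊥) :
    Algebra.trdeg K (S ⧸ P) + 1 ≤ Algebra.trdeg K S := by
  have : FaithfulSMul K (S ⧸ P) :=
    (faithfulSMul_iff_algebraMap_injective _ _).2 (algebraMap K (S ⧸ P)).injective
  obtain ⟨t, ht⟩ := exists_isTranscendenceBasis K (S ⧸ P)
  choose x hx using fun i : t => Ideal.Quotient.mk_surjective (I := P) i.1
  have hcomp : (Ideal.Quotient.mkₐ K P) ∘ x = ((↑) : t → S ⧸ P) := by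
    funext i; exact hx i
  have hind : AlgebraicIndependent K x :=
    AlgebraicIndependent.of_comp (Ideal.Quotient.mkₐ K P) (by rw [hcomp]; exact ht.1)
  obtain ⟨a, haP, ha⟩ := Submodule.exists_mem_ne_zero_of_ne_bot hP
  have htr : Transcendental (Algebra.adjoin K (Set.range x)) a := by
    intro halg
    refine Ideal.comap_ne_bot_of_algebraic_mem ha haP halg ?_
    rw [eq_bot_iff]
    rintro ⟨b, hb⟩ hbP
    rw [Algebra.adjoin_range_eq_range_aeval] at hb
    obtain ⟨p, rfl⟩ := hb
    have h0 : MvPolynomial.aeval ((↑) : t → S ⧸ P) p = 0 := by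
      rw [← hcomp]
      have := MvPolynomial.comp_aeval_apply (φ := Ideal.Quotient.mkₐ K P) x p
      rw [Function.comp_def, ← this]
      exact Ideal.Quotient.eq_zero_iff_mem.2 hbP
    have hp : p = 0 := by
      have := ht.1
      rw [algebraicIndependent_iff] at this
      exact this p h0
    subst hp
    exact (Submodule.mem_bot _).2 (Subtype.ext (map_zero _))
  have := ((hind.option_iff_transcendental a).2 htr).cardinalMk_le_trdeg
  rw [Cardinal.mk_option, ht.cardinalMk_eq_trdeg] at this
  exact this

theorem trdeg_le_ringKrullDim (K R : Type) [Field K] [CommRing R] [IsDomain R] [Algebra K R]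
    [Algebra.FiniteType K R] :
    ((Cardinal.toENat (Algebra.trdeg K R) : ℕ∞) : WithBot ℕ∞) ≤ ringKrullDim R := by
  obtain ⟨s, g, hinj, hint⟩ := exists_integral_inj_algHom_of_fg K R
  algebraize [g.toRingHom]
  have : IsScalarTower K (MvPolynomial (Fin s) K) R := .of_algebraMap_eq fun r => (g.commutes r).symm
  have : FaithfulSMul (MvPolynomial (Fin s) K) R :=
    (faithfulSMul_iff_algebraMap_injective _ _).2 hinj
  have htr := trdeg_add_eq K (MvPolynomial (Fin s) K) (A := R)
  rw [trdeg_eq_zero (R := MvPolynomial (Fin s) K), add_zero, MvPolynomial.trdeg_of_isDomain] at htr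
  have hdim : ringKrullDim (MvPolynomial (Fin s) K) = s := by simp
  have hdim' : (s : WithBot ℕ∞) ≤ Order.krullDim (PrimeSpectrum (MvPolynomial (Fin s) K)) := hdim.ge
  rw [Order.le_krullDim_iff] at hdim'
  obtain ⟨l, hl⟩ := hdim'
  obtain ⟨P, hP, hPl⟩ := Ideal.exists_ideal_over_prime_of_isIntegral l.head.asIdeal (⊥ : Ideal R)
    (by
      rw [← RingHom.ker_eq_comap_bot, (RingHom.injective_iff_ker_eq_bot (algebraMap (MvPolynomial (Fin s) K) R)).1 hinj]
      exact bot_le)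
  have : P.IsPrime := hPl.1
  have : P.LiesOver l.head.asIdeal := ⟨hPl.2.symm⟩
  obtain ⟨L, hL, -⟩ := Ideal.exists_ltSeries_of_hasGoingUp l P
  rw [← htr]
  simp only [Cardinal.lift_uzero, Cardinal.mk_fin, map_natCast]
  exact Order.le_krullDim_iff.2 ⟨L, by rw [hL, hl]⟩

theorem trdeg_le_sum {K L ι : Type} [Field K] [Field L] [Algebra K L] [Fintype ι]
    (E : ι → IntermediateField K L)
    (hE : ∀ F : IntermediateField K L, (∀ i, E i ≤ F) → F = ⊤) :
    Algebra.trdeg K L ≤ ∑ i, Algebra.trdeg K (E i) := by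
  have hsm (i) : FaithfulSMul K (E i) :=
    (faithfulSMul_iff_algebraMap_injective _ _).2 (algebraMap K (E i)).injective
  choose s hs using fun i => exists_isTranscendenceBasis K (E i)
  let S : Set L := ⋃ i, Subtype.val '' s i
  let F₀ : IntermediateField K L := IntermediateField.adjoin K S
  have htop : (algebraicClosure F₀ L).restrictScalars K = ⊤ := by
    refine hE _ fun i x hx => ?_
    have hle : (Algebra.adjoin K (Set.range ((↑) : s i → E i))).map (E i).val ≤
        F₀.toSubalgebra := by
      rw [AlgHom.map_adjoin, Algebra.adjoin_le_iff]
      rintro _ ⟨_, ⟨y, rfl⟩, rfl⟩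
      exact IntermediateField.subset_adjoin _ _ (Set.mem_iUnion.2 ⟨i, y, y.2, rfl⟩)
    have h1 := (hs i).isAlgebraic
    let f : Algebra.adjoin K (Set.range ((↑) : s i → E i)) →+* F₀ :=
      ((E i).val.comp (Subalgebra.val _)).toRingHom.codRestrict F₀
        fun y => hle ⟨y.1, y.2, rfl⟩
    have hf : Function.Injective f := fun a b h =>
      Subtype.ext (Subtype.ext (congrArg (Subtype.val : F₀ → L) h))
    exact mem_algebraicClosure_iff.2 <| (h1.isAlgebraic ⟨x, hx⟩).ringHom_of_comp_eq f (E i).val.toRingHom hf rfl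
  have halg : Algebra.IsAlgebraic F₀ L := ⟨fun x => by
    have : x ∈ (algebraicClosure F₀ L).restrictScalars K := htop ▸ IntermediateField.mem_top
    exact mem_algebraicClosure_iff.1 this⟩
  have halg' : Algebra.IsAlgebraic (Algebra.adjoin K S) L :=
    IntermediateField.isAlgebraic_adjoin_iff_top.1 halg
  refine (Algebra.IsAlgebraic.trdeg_le_cardinalMk K S).trans ?_
  have hcard (t : Finset ι) : Cardinal.mk (⋃ i ∈ t, Subtype.val '' s i : Set L) ≤
      ∑ i ∈ t, Algebra.trdeg K (E i) := by
    classical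
    induction t using Finset.induction_on with
    | empty => simp
    | insert a t ha ih =>
      rw [Finset.set_biUnion_insert, Finset.sum_insert ha]
      refine (Cardinal.mk_union_le _ _).trans (add_le_add ?_ ih)
      exact Cardinal.mk_image_le.trans_eq (hs a).cardinalMk_eq_trdeg
  simpa [S] using hcard Finset.univ

theorem trdeg_fractionRing_quotient {K R L : Type} [Field K] [CommRing R] [IsDomain R] [Field L]
    [Algebra K R] [Algebra K L] [Algebra R L] [IsScalarTower K R L] [IsFractionRing R L] :
    Algebra.trdeg K L = Algebra.trdeg K R := by
  have : FaithfulSMul K R :=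
    (faithfulSMul_iff_algebraMap_injective _ _).2 (algebraMap K R).injective
  have : Algebra.IsAlgebraic R L := IsLocalization.isAlgebraic L (nonZeroDivisors R)
  rw [← trdeg_add_eq K R, trdeg_eq_zero (R := R), add_zero]

/-- The transcendence degree of a ring homomorphism from a field, as an extended natural number. -/
def homTrdeg {K L : Type} [Field K] [CommRing L] (φ : K →+* L) : ℕ∞ :=
  letI := φ.toAlgebra
  Cardinal.toENat (Algebra.trdeg K L)

theorem homTrdeg_algebraMap (K L : Type) [Field K] [CommRing L] [Algebra K L] :
    homTrdeg (algebraMap K L) = Cardinal.toENat (Algebra.trdeg K L) := by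
  unfold homTrdeg
  congr!
  exact Algebra.algebra_ext _ _ fun _ => rfl

theorem homTrdeg_le_of_injective {K L L' : Type} [Field K] [CommRing L] [CommRing L']
    (φ : K →+* L) (ψ : L →+* L') (hψ : Function.Injective ψ) :
    homTrdeg φ ≤ homTrdeg (ψ.comp φ) := by
  let := φ.toAlgebra
  let := (ψ.comp φ).toAlgebra
  let ψ' : L →ₐ[K] L' := { ψ with commutes' := fun _ => rfl }
  exact OrderHomClass.mono Cardinal.toENat (trdeg_le_of_injective ψ' hψ)

theorem homTrdeg_comp_of_bijective {K L L' : Type} [Field K] [CommRing L] [CommRing L']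
    (φ : K →+* L) (ψ : L →+* L') (hψ : Function.Bijective ψ) :
    homTrdeg (ψ.comp φ) = homTrdeg φ := by
  refine le_antisymm ?_ (homTrdeg_le_of_injective φ ψ hψ.1)
  let e := RingEquiv.ofBijective ψ hψ
  have := homTrdeg_le_of_injective (ψ.comp φ) e.symm.toRingHom e.symm.injective
  rwa [show e.symm.toRingHom.comp (ψ.comp φ) = φ from
    RingHom.ext fun a => e.symm_apply_apply _] at this

/-- The transcendence degree over `K` of the residue field at a point of a `K`-scheme. -/
def ptTrdeg {K : Type} [Field K] {W : Over (SpecK K)} (x : W.left) : ℕ∞ :=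
  homTrdeg (Spec.preimage (W.left.fromSpecResidueField x ≫ W.hom)).hom

theorem preimage_fromSpecResidueField_comp {K : Type} [Field K] {W W' : Over (SpecK K)}
    (f : W ⟶ W') (x : W.left) :
    Spec.preimage (W.left.fromSpecResidueField x ≫ W.hom) =
      Spec.preimage (W'.left.fromSpecResidueField (f.left x) ≫ W'.hom) ≫
        f.left.residueFieldMap x := by
  apply Spec.map_injective
  rw [Spec.map_comp, Spec.map_preimage, Spec.map_preimage,
    Scheme.Hom.SpecMap_residueFieldMap_fromSpecResidueField_assoc, Over.w f]

theorem ptTrdeg_map_le {K : Type} [Field K] {W W' : Over (SpecK K)} (f : W ⟶ W') (x : W.left) :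
    ptTrdeg (f.left x) ≤ ptTrdeg x := by
  unfold ptTrdeg
  rw [preimage_fromSpecResidueField_comp f x, CommRingCat.hom_comp]
  exact homTrdeg_le_of_injective _ _ (f.left.residueFieldMap x).hom.injective

theorem ptTrdeg_map_of_isOpenImmersion {K : Type} [Field K] {W W' : Over (SpecK K)} (f : W ⟶ W')
    [IsOpenImmersion f.left] (x : W.left) :
    ptTrdeg (f.left x) = ptTrdeg x := by
  unfold ptTrdeg
  rw [preimage_fromSpecResidueField_comp f x, CommRingCat.hom_comp]
  exact (homTrdeg_comp_of_bijective _ _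
    (ConcreteCategory.bijective_of_isIso (f.left.residueFieldMap x))).symm

instance isPrime_asIdeal_of_Spec {R : CommRingCat.{0}} (p : Spec R) : p.asIdeal.IsPrime :=
  PrimeSpectrum.isPrime p

theorem preimage_fromSpecResidueField_Spec {K : Type} [Field K] {R : CommRingCat.{0}}
    (φ : CommRingCat.of K ⟶ R) (p : Spec R) :
    Spec.preimage ((Spec R).fromSpecResidueField p ≫ Spec.map φ) =
      φ ≫ CommRingCat.ofHom (algebraMap R p.asIdeal.ResidueField) ≫
        (Scheme.Spec.residueFieldIso R p).inv := by
  apply Spec.map_injective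
  rw [Spec.map_preimage, Spec.map_comp, Spec.map_comp,
    Scheme.Spec.map_residueFieldIso_inv_eq_fromSpecResidueField]

theorem homTrdeg_algebraMap_residueField {K R : Type} [Field K] [CommRing R] (φ : K →+* R)
    (p : Ideal R) [p.IsPrime] :
    homTrdeg ((algebraMap R p.ResidueField).comp φ) =
      homTrdeg ((Ideal.Quotient.mk p).comp φ) := by
  algebraize [φ]
  have h1 : (algebraMap R p.ResidueField).comp φ = algebraMap K p.ResidueField := by
    rw [← RingHom.algebraMap_toAlgebra φ]
    exact (IsScalarTower.algebraMap_eq K R p.ResidueField).symm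
  have h2 : (Ideal.Quotient.mk p).comp φ = algebraMap K (R ⧸ p) := rfl
  rw [h1, h2, homTrdeg_algebraMap, homTrdeg_algebraMap]
  congr 1
  exact trdeg_fractionRing_quotient

theorem ptTrdeg_Spec {K : Type} [Field K] {R : CommRingCat.{0}} (φ : CommRingCat.of K ⟶ R)
    (p : Spec R) :
    ptTrdeg (W := Over.mk (Spec.map φ)) p = homTrdeg ((Ideal.Quotient.mk p.asIdeal).comp φ.hom) := by
  have h1 : ptTrdeg (W := Over.mk (Spec.map φ)) p =
      homTrdeg (Spec.preimage ((Spec R).fromSpecResidueField p ≫ Spec.map φ)).hom := rfl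
  rw [h1, preimage_fromSpecResidueField_Spec, ← Category.assoc, CommRingCat.hom_comp,
    homTrdeg_comp_of_bijective _ _
      (ConcreteCategory.bijective_of_isIso (Scheme.Spec.residueFieldIso R p).inv)]
  exact homTrdeg_algebraMap_residueField φ.hom p.asIdeal

theorem homTrdeg_quotient_lt_top {K R : Type} [Field K] [CommRing R] {φ : K →+* R}
    (hφ : φ.FiniteType) (p : Ideal R) [p.IsPrime] :
    homTrdeg ((Ideal.Quotient.mk p).comp φ) < ⊤ := by
  algebraize [φ]
  have h2 : (Ideal.Quotient.mk p).comp φ = algebraMap K (R ⧸ p) := rfl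
  rw [h2, homTrdeg_algebraMap]
  exact Cardinal.toENat_lt_top.2 trdeg_lt_aleph0_of_finiteType

theorem homTrdeg_quotient_le_ringKrullDim {K R : Type} [Field K] [CommRing R] {φ : K →+* R}
    (hφ : φ.FiniteType) (p : Ideal R) [p.IsPrime] :
    (homTrdeg ((Ideal.Quotient.mk p).comp φ) : WithBot ℕ∞) ≤ ringKrullDim (R ⧸ p) := by
  algebraize [φ]
  have h2 : (Ideal.Quotient.mk p).comp φ = algebraMap K (R ⧸ p) := rfl
  rw [h2, homTrdeg_algebraMap]
  exact trdeg_le_ringKrullDim K (R ⧸ p)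

theorem homTrdeg_quotient_add_one_le {K R : Type} [Field K] [CommRing R] (φ : K →+* R)
    {p q : Ideal R} [p.IsPrime] [q.IsPrime] (hqp : q < p) :
    homTrdeg ((Ideal.Quotient.mk p).comp φ) + 1 ≤ homTrdeg ((Ideal.Quotient.mk q).comp φ) := by
  algebraize [φ]
  have h1 : (Ideal.Quotient.mk p).comp φ = algebraMap K (R ⧸ p) := rfl
  have h2 : (Ideal.Quotient.mk q).comp φ = algebraMap K (R ⧸ q) := rfl
  rw [h1, h2, homTrdeg_algebraMap, homTrdeg_algebraMap]
  let f : (R ⧸ q) →ₐ[K] (R ⧸ p) := Ideal.Quotient.factorₐ K hqp.le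
  have hf : Function.Surjective f := Ideal.Quotient.factor_surjective hqp.le
  have hker : RingHom.ker f ≠ ⊥ := by
    obtain ⟨a, hap, haq⟩ := SetLike.exists_of_lt hqp
    intro h
    have : Ideal.Quotient.mk q a ∈ RingHom.ker f := Ideal.Quotient.eq_zero_iff_mem.2 hap
    rw [h] at this
    exact haq (Ideal.Quotient.eq_zero_iff_mem.1 this)
  have : (RingHom.ker f).IsPrime := RingHom.ker_isPrime f
  have := trdeg_quotient_add_one_le (K := K) (RingHom.ker f) hker
  rw [(Ideal.quotientKerAlgEquivOfSurjective hf).trdeg_eq] at this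
  simpa using OrderHomClass.mono Cardinal.toENat this

theorem exists_affine_chart {K : Type} [Field K] {W : Over (SpecK K)} [LocallyOfFiniteType W.hom]
    {U : Set W.left} (hU : IsOpen U) {x : W.left} (hx : x ∈ U) :
    ∃ (R : CommRingCat.{0}) (φ : CommRingCat.of K ⟶ R) (j : Over.mk (Spec.map φ) ⟶ W),
      φ.hom.FiniteType ∧ IsOpenImmersion j.left ∧ x ∈ Set.range j.left ∧ Set.range j.left ⊆ U := by
  obtain ⟨R, j, hj, hxj, hjU⟩ :=
    Scheme.exists_affine_mem_range_and_range_subset (X := W.left) (U := ⟨U, hU⟩) hx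
  refine ⟨R, Spec.preimage (j ≫ W.hom), Over.homMk j (by simp), ?_, hj, hxj, hjU⟩
  rw [← HasRingHomProperty.Spec_iff (P := @LocallyOfFiniteType), Spec.map_preimage]
  infer_instance

theorem ptTrdeg_lt_top {K : Type} [Field K] {W : Over (SpecK K)} [LocallyOfFiniteType W.hom]
    (x : W.left) : ptTrdeg x < ⊤ := by
  obtain ⟨R, φ, j, hφ, hj, ⟨p, rfl⟩, -⟩ := exists_affine_chart isOpen_univ (Set.mem_univ x)
  rw [ptTrdeg_map_of_isOpenImmersion]
  have := homTrdeg_quotient_lt_top hφ (PrimeSpectrum.asIdeal p)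
  rwa [← ptTrdeg_Spec] at this

theorem ptTrdeg_add_one_le {K : Type} [Field K] {W : Over (SpecK K)} [LocallyOfFiniteType W.hom]
    {x y : W.left} (h : y ⤳ x) (hne : y ≠ x) : ptTrdeg x + 1 ≤ ptTrdeg y := by
  obtain ⟨R, φ, j, hφ, hj, ⟨p, rfl⟩, -⟩ := exists_affine_chart isOpen_univ (Set.mem_univ x)
  obtain ⟨q, rfl⟩ : y ∈ Set.range j.left :=
    h.mem_open j.left.isOpenEmbedding.isOpen_range ⟨p, rfl⟩
  rw [ptTrdeg_map_of_isOpenImmersion, ptTrdeg_map_of_isOpenImmersion]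
  have hqp : q ⤳ p := j.left.isOpenEmbedding.isInducing.specializes_iff.1 h
  have hlt : PrimeSpectrum.asIdeal q < PrimeSpectrum.asIdeal p := by
    refine lt_of_le_of_ne ((PrimeSpectrum.le_iff_specializes q p).2 hqp) fun h => hne ?_
    rw [show q = p from PrimeSpectrum.ext h]
  have := homTrdeg_quotient_add_one_le φ.hom hlt
  rwa [← ptTrdeg_Spec, ← ptTrdeg_Spec] at this

theorem ptTrdeg_le_of_specializes {K : Type} [Field K] {W : Over (SpecK K)}
    [LocallyOfFiniteType W.hom] {x y : W.left} (h : y ⤳ x) : ptTrdeg x ≤ ptTrdeg y := by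
  by_cases hne : y = x
  · rw [hne]
  · exact le_self_add.trans (ptTrdeg_add_one_le h hne)

theorem ptTrdeg_le_sum_of_factor {K : Type} [Field K] {W : Over (SpecK K)} {ι : Type} [Fintype ι]
    {Y : ι → Over (SpecK K)} (g : ∀ i, W ⟶ Y i)
    (hg : ∀ {A B : Over (SpecK K)} (b : A ⟶ B) (a : A ⟶ W),
      (∀ i, ∃ c, b ≫ c = a ≫ g i) → ∃ c, b ≫ c = a)
    (x : W.left) : ptTrdeg x ≤ ∑ i, ptTrdeg ((g i).left x) := by
  let φ := Spec.preimage (W.left.fromSpecResidueField x ≫ W.hom)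
  let φi (i) := Spec.preimage ((Y i).left.fromSpecResidueField ((g i).left x) ≫ (Y i).hom)
  have hφ (i) : φ = φi i ≫ (g i).left.residueFieldMap x :=
    preimage_fromSpecResidueField_comp (g i) x
  let : Algebra K (W.left.residueField x) := φ.hom.toAlgebra
  let inst (i) : Algebra K ((Y i).left.residueField ((g i).left x)) := (φi i).hom.toAlgebra
  let ψ (i) : (Y i).left.residueField ((g i).left x) →ₐ[K] W.left.residueField x :=
    { ((g i).left.residueFieldMap x).hom with
      commutes' := fun r => (congrArg (fun f => CommRingCat.Hom.hom f r) (hφ i)).symm }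
  have key := trdeg_le_sum (fun i => (ψ i).fieldRange) (fun F hF => by
    let incl : CommRingCat.of F ⟶ W.left.residueField x := CommRingCat.ofHom F.val.toRingHom
    let φF : CommRingCat.of K ⟶ CommRingCat.of F := CommRingCat.ofHom (algebraMap K F)
    have hincl : φF ≫ incl = φ := rfl
    let A : Over (SpecK K) := Over.mk (Spec.map φ)
    let B : Over (SpecK K) := Over.mk (Spec.map φF)
    let b : A ⟶ B := Over.homMk (Spec.map incl) (by
      change Spec.map incl ≫ Spec.map φF = Spec.map φ
      rw [← Spec.map_comp, hincl])
    let a : A ⟶ W := Over.homMk (W.left.fromSpecResidueField x) (by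
      change _ = Spec.map φ
      rw [Spec.map_preimage])
    obtain ⟨c, hc⟩ := hg b a (fun i => by
      let ρ : (Y i).left.residueField ((g i).left x) ⟶ CommRingCat.of F :=
        CommRingCat.ofHom ((ψ i).toRingHom.codRestrict F fun r => hF i ⟨r, rfl⟩)
      have hρ : ρ ≫ incl = (g i).left.residueFieldMap x := rfl
      have hρ' : φi i ≫ ρ = φF := by
        ext r
        exact (ψ i).commutes r
      refine ⟨Over.homMk (Spec.map ρ ≫ (Y i).left.fromSpecResidueField _) ?_, ?_⟩
      · change _ = Spec.map φF
        rw [← hρ', Spec.map_comp, Spec.map_preimage, Category.assoc]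
      · ext1
        change Spec.map incl ≫ Spec.map ρ ≫ _ = W.left.fromSpecResidueField x ≫ (g i).left
        rw [← Spec.map_comp_assoc, hρ, Scheme.Hom.SpecMap_residueFieldMap_fromSpecResidueField])
    have hc' : Spec.map incl ≫ c.left = W.left.fromSpecResidueField x := congrArg (·.left) hc
    obtain ⟨⟨y, θ⟩, hθ⟩ := (Scheme.SpecToEquivOfField F W.left).symm.surjective c.left
    have hθ' : Spec.map θ ≫ W.left.fromSpecResidueField y = c.left := hθ
    have hxy : y = x := by
      have h1 : (W.left.fromSpecResidueField x) default = x :=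
        Scheme.fromSpecResidueField_apply _ _
      rw [← hc', ← hθ', Scheme.Hom.comp_apply, Scheme.Hom.comp_apply,
        Scheme.fromSpecResidueField_apply] at h1
      exact h1
    subst hxy
    have hid : θ ≫ incl = 𝟙 _ := by
      apply Spec.map_injective
      rw [← cancel_mono (W.left.fromSpecResidueField y), Spec.map_comp, Category.assoc, hθ', hc',
        Spec.map_id, Category.id_comp]
    rw [eq_top_iff]
    intro r _
    have h : ((θ.hom r : F) : W.left.residueField y) = r :=
      congrArg (fun f => CommRingCat.Hom.hom f r) hid
    exact h ▸ (θ.hom r).2)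
  have h1 : ptTrdeg x = Cardinal.toENat (Algebra.trdeg K (W.left.residueField x)) := rfl
  have h2 (i) : ptTrdeg ((g i).left x) = Cardinal.toENat (Algebra.trdeg K (ψ i).fieldRange) := by
    exact congrArg Cardinal.toENat (AlgEquiv.ofInjectiveField (ψ i)).trdeg_eq
  simp only [h1, h2, ← map_sum]
  exact OrderHomClass.mono Cardinal.toENat key

theorem overObj_isClosedUnderBinaryProducts {C : Type*} [Category C] [HasPullbacks C]
    (P : MorphismProperty C) [P.IsStableUnderBaseChange] [P.IsStableUnderComposition] {S : C} :
    (P.overObj (X := S)).IsClosedUnderBinaryProducts where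
  limitsOfShape_le := by
    rintro Y ⟨p⟩
    have hc : IsLimit (BinaryFan.mk (p.π.app ⟨.left⟩) (p.π.app ⟨.right⟩)) :=
      (IsLimit.postcomposeHomEquiv (diagramIsoPair _) _).symm p.isLimit |>.ofIsoLimit
        (Cone.ext (Iso.refl _) (by rintro ⟨_ | _⟩ <;> simp))
    have h := Over.isPullback_of_binaryFan_isLimit _ hc
    have h1 : P (p.π.app ⟨.left⟩).left := P.of_isPullback h.flip (p.prop_diag_obj ⟨.right⟩)
    have h2 := P.comp_mem _ _ h1 (p.prop_diag_obj ⟨.left⟩)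
    rwa [Over.w] at h2

theorem property_pow_hom {K : Type} [Field K] (P : MorphismProperty Scheme)
    [P.IsStableUnderBaseChange] [P.IsMultiplicative] {V : Over (SpecK K)}
    (hV : P V.hom) (Ω : Type) [Finite Ω] : P (pow K V Ω).hom := by
  have := overObj_isClosedUnderBinaryProducts P (S := SpecK K)
  have : (P.overObj (X := SpecK K)).IsClosedUnderFiniteProducts :=
    ObjectProperty.IsClosedUnderFiniteProducts.mk'
  exact (P.overObj (X := SpecK K)).prop_product (f := fun _ : Ω => V) fun _ => hV

theorem noetherianSpace_left {K : Type} [Field K] (W : Over (SpecK K))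
    [LocallyOfFiniteType W.hom] [QuasiCompact W.hom] : TopologicalSpace.NoetherianSpace W.left := by
  have : IsLocallyNoetherian W.left := LocallyOfFiniteType.isLocallyNoetherian W.hom
  have : CompactSpace W.left :=
    QuasiCompact.compactSpace_of_compactSpace W.hom
  have : IsNoetherian W.left := ⟨⟩
  infer_instance

theorem jacobsonSpace_left {K : Type} [Field K] (W : Over (SpecK K))
    [LocallyOfFiniteType W.hom] : JacobsonSpace W.left :=
  LocallyOfFiniteType.jacobsonSpace W.hom

theorem exists_ev_eq {K : Type} [Field K] [IsAlgClosed K] {W : Over (SpecK K)}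
    [LocallyOfFiniteType W.hom] {x : W.left} (hx : IsClosed {x}) : ∃ a : Pt K W, ev K a = x :=
  ⟨Over.homMk (pointOfClosedPoint W.hom x hx) (pointOfClosedPoint_comp _ _ _),
    pointOfClosedPoint_apply W.hom x hx _⟩

/-- The projections of the fibered power. -/
def powπ {K : Type} [Field K] (V : Over (SpecK K)) {Ω : Type} [Finite Ω] (ω : Ω) :
    pow K V Ω ⟶ V :=
  Pi.π (fun _ : Ω => V) ω

/-- The morphism to the fibered power with given components. -/
def powLift {K : Type} [Field K] {W V : Over (SpecK K)} {Ω : Type} [Finite Ω] (g : Ω → (W ⟶ V)) :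
    W ⟶ pow K V Ω :=
  Pi.lift g

@[simp]
theorem powLift_powπ {K : Type} [Field K] {W V : Over (SpecK K)} {Ω : Type} [Finite Ω]
    (g : Ω → (W ⟶ V)) (ω : Ω) : powLift g ≫ powπ V ω = g ω :=
  Pi.lift_π g ω

@[simp]
theorem ptPow_powπ {K : Type} [Field K] {V : Over (SpecK K)} {Ω : Type} [Finite Ω]
    (u : Ω → Pt K V) (ω : Ω) : ptPow K V Ω u ≫ powπ V ω = u ω :=
  Pi.lift_π u ω

theorem pow_hom_ext {K : Type} [Field K] {W V : Over (SpecK K)} {Ω : Type} [Finite Ω]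
    {g h : W ⟶ pow K V Ω} (H : ∀ ω, g ≫ powπ V ω = h ≫ powπ V ω) : g = h :=
  Pi.hom_ext g h H

theorem ptPow_surjective {K : Type} [Field K] (V : Over (SpecK K)) (Ω : Type) [Finite Ω] :
    Function.Surjective (ptPow K V Ω) := fun a =>
  ⟨fun ω => a ≫ powπ V ω, pow_hom_ext fun _ => ptPow_powπ _ _⟩

theorem exists_ev_ptPow_mem {K : Type} [Field K] [IsAlgClosed K] {V : Over (SpecK K)} {Ω : Type}
    [Finite Ω] [LocallyOfFiniteType (pow K V Ω).hom] {Z : Set (pow K V Ω).left}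
    (hZ : IsLocallyClosed Z) (hne : Z.Nonempty) : ∃ u, ev K (ptPow K V Ω u) ∈ Z := by
  have := jacobsonSpace_left (pow K V Ω)
  obtain ⟨x, hx, hx'⟩ := nonempty_inter_closedPoints hne hZ
  obtain ⟨a, rfl⟩ := exists_ev_eq hx'
  obtain ⟨u, rfl⟩ := ptPow_surjective V Ω a
  exact ⟨u, hx⟩

theorem exists_ptTrdeg_le {K : Type} [Field K] (W : Over (SpecK K))
    [LocallyOfFiniteType W.hom] [QuasiCompact W.hom] : ∃ d : ℕ, ∀ x : W.left, ptTrdeg x ≤ d := by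
  have := noetherianSpace_left W
  have hfin := TopologicalSpace.NoetherianSpace.finite_irreducibleComponents (α := W.left)
  have := hfin.fintype
  let η (Z : irreducibleComponents W.left) : W.left := Z.2.1.genericPoint
  refine ⟨∑ Z, (ptTrdeg (η Z)).toNat, fun x => ?_⟩
  let Z : irreducibleComponents W.left :=
    ⟨irreducibleComponent x, irreducibleComponent_mem_irreducibleComponents x⟩
  have h : η Z ⤳ x := by
    rw [specializes_iff_mem_closure]
    have := Z.2.1.isGenericPoint_genericPoint_closure
    rw [this.def]
    exact subset_closure mem_irreducibleComponent
  refine (ptTrdeg_le_of_specializes h).trans ?_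
  rw [← ENat.natCast_toNat (ptTrdeg_lt_top (η Z)).ne, Nat.cast_le]
  exact Finset.single_le_sum (f := fun Z => (ptTrdeg (η Z)).toNat) (fun _ _ => Nat.zero_le _)
    (Finset.mem_univ Z)

theorem ptTrdeg_pow_le {K : Type} [Field K] {V : Over (SpecK K)} {Ω Ω' : Type} [Finite Ω]
    [Finite Ω'] (r : Ω' → Ω) (T : Finset Ω) (hT : ∀ ω, ω ∈ Set.range r ∨ ω ∈ T)
    (x : (pow K V Ω).left) :
    ptTrdeg x ≤ ptTrdeg ((powLift fun ω => powπ V (r ω)).left x) +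
      ∑ ω ∈ T, ptTrdeg ((powπ V ω).left x) := by
  let Y : Option T → Over (SpecK K) := fun i => i.elim (pow K V Ω') fun _ => V
  let g : ∀ i, pow K V Ω ⟶ Y i := fun i => match i with
    | none => powLift fun ω => powπ V (r ω)
    | some ω => powπ V ω.1
  refine (ptTrdeg_le_sum_of_factor g (fun {A B} b a h => ?_) x).trans ?_
  · have h' (ω : Ω) : ∃ c, b ≫ c = a ≫ powπ V ω := by
      rcases hT ω with ⟨ω', rfl⟩ | hω
      · obtain ⟨c, hc⟩ : ∃ c, b ≫ c = a ≫ powLift fun ω => powπ V (r ω) := h none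
        refine ⟨c ≫ powπ V ω', ?_⟩
        rw [← Category.assoc, hc, Category.assoc, powLift_powπ]
      · exact h (some ⟨ω, hω⟩)
    choose c hc using h'
    refine ⟨powLift c, pow_hom_ext fun ω => ?_⟩
    rw [Category.assoc, powLift_powπ, hc]
  · rw [Fintype.sum_option, ← Finset.sum_coe_sort T]
    exact le_rfl

theorem exists_isIrreducible_subset_mem_closure {X : Type*} [TopologicalSpace X]
    [TopologicalSpace.NoetherianSpace X] {S : Set X} {x : X} (hx : x ∈ closure S) :
    ∃ T ⊆ S, IsIrreducible T ∧ x ∈ closure T := by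
  obtain ⟨F, hF, -, hirr, huniv⟩ :=
    TopologicalSpace.NoetherianSpace.exists_finite_set_isClosed_irreducible
      (isClosed_univ (X := S))
  have hS : S = ⋃ t ∈ F, Subtype.val '' t := by
    rw [← Set.image_iUnion₂, ← Set.sUnion_eq_biUnion, ← huniv, Set.image_univ, Subtype.range_val]
  rw [hS, hF.closure_biUnion] at hx
  obtain ⟨t, ht, hx⟩ := Set.mem_iUnion₂.1 hx
  exact ⟨_, Subtype.coe_image_subset S t, (hirr t ht).image _ continuous_subtype_val.continuousOn,
    hx⟩

theorem topologicalKrullDim_le_of_isInducing_of_dense {X Y : Type*} [TopologicalSpace X]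
    [TopologicalSpace Y] {f : X → Y} (hf : IsInducing f)
    (hd : ∀ Z : Set Y, IsLocallyClosed Z → Z.Nonempty → ∃ x, f x ∈ Z) :
    topologicalKrullDim Y ≤ topologicalKrullDim X := by
  let g (C : TopologicalSpace.IrreducibleCloseds Y) : TopologicalSpace.IrreducibleCloseds X :=
    { carrier := f ⁻¹' C
      isIrreducible' := by
        refine ⟨hd C C.isClosed.isLocallyClosed C.isIrreducible.nonempty, ?_⟩
        rintro _ _ hu hv ⟨x, hx, hxu⟩ ⟨y, hy, hyv⟩
        obtain ⟨u, hu', rfl⟩ := hf.isOpen_iff.1 hu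
        obtain ⟨v, hv', rfl⟩ := hf.isOpen_iff.1 hv
        exact hd (C ∩ (u ∩ v)) (C.isClosed.isLocallyClosed.inter (hu'.inter hv').isLocallyClosed)
          (C.isIrreducible.2 u v hu' hv' ⟨f x, hx, hxu⟩ ⟨f y, hy, hyv⟩)
      isClosed' := C.isClosed.preimage hf.continuous }
  refine Order.krullDim_le_of_strictMono g fun C C' h => ?_
  have hle : (C : Set Y) ⊆ C' := h.le
  obtain ⟨y, hy', hy⟩ := SetLike.exists_of_lt h
  obtain ⟨x, hx', hx⟩ := hd (C' \ C) (C'.isClosed.isLocallyClosed.inter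
    C.isClosed.isOpen_compl.isLocallyClosed) ⟨y, hy', hy⟩
  exact lt_of_le_of_ne (fun x hx => hle hx) fun h => hx (show x ∈ g C from h ▸ hx')

theorem topologicalKrullDim_le_of_ptTrdeg_le {K : Type} [Field K] {W : Over (SpecK K)}
    [LocallyOfFiniteType W.hom] {D : Type} [TopologicalSpace D] {e : D → W.left}
    (he : IsInducing e) {n : ℕ} (h : ∀ x ∈ closure (Set.range e), ptTrdeg x ≤ n) :
    topologicalKrullDim D ≤ n := by
  let C (Z : TopologicalSpace.IrreducibleCloseds D) := Z.map e he.continuous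
  let η (Z : TopologicalSpace.IrreducibleCloseds D) : W.left := (C Z).isIrreducible.genericPoint
  have hη (Z) : IsGenericPoint (η Z) (C Z : Set W.left) :=
    (C Z).isIrreducible.isGenericPoint_genericPoint (C Z).isClosed
  have hmono : StrictMono fun Z => (ptTrdeg (η Z)).toNat := by
    intro Z Z' hZ
    have hC : C Z < C Z' := TopologicalSpace.IrreducibleCloseds.map_strictMono_of_isInducing he hZ
    have hsp : η Z' ⤳ η Z := (hη Z').specializes (hC.le (hη Z).mem)
    have hne : η Z' ≠ η Z := fun h => hC.ne (SetLike.coe_injective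
      ((hη Z).def.symm.trans (h ▸ (hη Z').def)))
    have := ptTrdeg_add_one_le hsp hne
    rw [← ENat.natCast_toNat (ptTrdeg_lt_top (η Z)).ne,
      ← ENat.natCast_toNat (ptTrdeg_lt_top (η Z')).ne] at this
    exact_mod_cast this
  refine iSup_le fun p => ?_
  have h1 := (p.map _ hmono).head_add_length_le_nat
  have h2 : (ptTrdeg (η p.last)).toNat ≤ n := by
    refine ENat.toNat_le_of_le_natCast (h _ ?_)
    exact closure_mono (Set.image_subset_range _ _) (hη p.last).mem
  have h3 : (p.map _ hmono).last = (ptTrdeg (η p.last)).toNat := rfl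
  have : p.length ≤ n := by
    have : (p.map _ hmono).length = p.length := rfl
    omega
  exact_mod_cast this

theorem ptTrdeg_le_topologicalKrullDim {K : Type} [Field K] {W : Over (SpecK K)}
    [LocallyOfFiniteType W.hom] {Y : Type} [TopologicalSpace Y] {e : Y → W.left}
    (he : IsInducing e) (hd : ∀ Z : Set W.left, IsLocallyClosed Z → Z.Nonempty → ∃ u, e u ∈ Z)
    {S : Set W.left} (hS : IsLocallyClosed S) {y : W.left} (hy : y ∈ S) :
    (ptTrdeg y : WithBot ℕ∞) ≤ topologicalKrullDim (e ⁻¹' S) := by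
  obtain ⟨U, Z, hU, hZ, rfl⟩ := hS
  obtain ⟨R, φ, j, hφ, hj, ⟨p, rfl⟩, hjU⟩ := exists_affine_chart hU hy.1
  let Q := PrimeSpectrum (R ⧸ p.asIdeal)
  let i : Q → PrimeSpectrum R := PrimeSpectrum.comap (Ideal.Quotient.mk p.asIdeal)
  have hi : IsClosedEmbedding i :=
    PrimeSpectrum.isClosedEmbedding_comap_of_surjective _ _ Ideal.Quotient.mk_surjective
  have hjo : IsOpenEmbedding j.left := j.left.isOpenEmbedding
  let g : Q → W.left := fun q => j.left (i q)
  have hg : IsEmbedding g := hjo.isEmbedding.comp hi.isEmbedding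
  have hgS : Set.range g ⊆ U ∩ Z := by
    rintro _ ⟨q, rfl⟩
    refine ⟨hjU ⟨i q, rfl⟩, ?_⟩
    have hsp : p ⤳ i q := by
      refine (PrimeSpectrum.le_iff_specializes p (i q)).1 ?_
      intro a ha
      change Ideal.Quotient.mk p.asIdeal a ∈ q.asIdeal
      rw [Ideal.Quotient.eq_zero_iff_mem.2 ha]
      exact zero_mem _
    exact (hsp.map hjo.continuous).mem_closed hZ hy.2
  have hglc {C : Set Q} (hC : IsLocallyClosed C) : IsLocallyClosed (g '' C) := by
    have h := IsLocallyClosed.image (f := j.left)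
      (hC.image hi.isInducing hi.isClosed_range.isLocallyClosed) hjo.isInducing
      hjo.isOpen_range.isLocallyClosed
    convert h using 1
    exact (Set.image_image _ _ _).symm
  let Y' := {u : Y // e u ∈ Set.range g}
  let e' : Y' → Q := fun u => u.2.choose
  have he' (u : Y') : g (e' u) = e u.1 := u.2.choose_spec
  have hind : IsInducing e' := by
    refine IsInducing.of_comp_iff hg.isInducing |>.1 ?_
    rw [show g ∘ e' = e ∘ Subtype.val from funext he']
    exact he.comp .subtypeVal
  have h1 : topologicalKrullDim Q ≤ topologicalKrullDim Y' := by
    refine topologicalKrullDim_le_of_isInducing_of_dense hind fun C hC hne => ?_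
    obtain ⟨u, q, hq, hu⟩ := hd _ (hglc hC) (hne.image g)
    refine ⟨⟨u, q, hu⟩, ?_⟩
    rwa [hg.injective ((he' ⟨u, q, hu⟩).trans hu.symm)]
  have h2 : topologicalKrullDim Y' ≤ topologicalKrullDim (e ⁻¹' (U ∩ Z)) :=
    (IsEmbedding.inclusion (t := e ⁻¹' (U ∩ Z))
      fun u hu => hgS hu).isInducing.topologicalKrullDim_le
  refine le_trans ?_ (h1.trans h2)
  rw [PrimeSpectrum.topologicalKrullDim_eq_ringKrullDim, ptTrdeg_map_of_isOpenImmersion j p]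
  erw [ptTrdeg_Spec φ p]
  exact homTrdeg_quotient_le_ringKrullDim hφ p.asIdeal

theorem ptTrdeg_le_of_isConstr {K : Type} [Field K] {W : Over (SpecK K)}
    [LocallyOfFiniteType W.hom] [QuasiCompact W.hom] {Y : Type} [TopologicalSpace Y]
    {e : Y → W.left} (he : IsInducing e)
    (hd : ∀ Z : Set W.left, IsLocallyClosed Z → Z.Nonempty → ∃ u, e u ∈ Z)
    {D : Set Y} (hD : IsConstr D) {x : W.left} (hx : x ∈ closure (e '' D)) :
    (ptTrdeg x : WithBot ℕ∞) ≤ topologicalKrullDim D := by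
  have := noetherianSpace_left W
  obtain ⟨n, U, Z, hU, hZ, rfl⟩ := hD
  rw [Set.image_iUnion, closure_iUnion_of_finite] at hx
  obtain ⟨i, hx⟩ := Set.mem_iUnion.1 hx
  obtain ⟨U', hU', hUe⟩ := he.isOpen_iff.1 (hU i)
  obtain ⟨Z', hZ', hZe⟩ := he.isClosed_iff.1 (hZ i)
  have hx' : x ∈ closure (U' ∩ Z') := by
    refine closure_mono ?_ hx
    rw [← hUe, ← hZe, ← Set.preimage_inter]
    exact Set.image_preimage_subset _ _
  obtain ⟨T, hTS, hT, hxT⟩ := exists_isIrreducible_subset_mem_closure hx'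
  have hη := hT.isGenericPoint_genericPoint_closure
  obtain ⟨t, ht⟩ := hT.nonempty
  have hηS : hT.genericPoint ∈ U' ∩ Z' :=
    ⟨(hη.specializes (subset_closure ht)).mem_open hU' (hTS ht).1,
      closure_minimal (fun t ht => (hTS ht).2) hZ' hη.mem⟩
  refine (WithBot.coe_le_coe.2 (ptTrdeg_le_of_specializes (hη.specializes hxT))).trans ?_
  refine (ptTrdeg_le_topologicalKrullDim he hd ⟨U', Z', hU', hZ', rfl⟩ hηS).trans ?_
  refine (IsEmbedding.inclusion (fun u hu => ?_)).isInducing.topologicalKrullDim_le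
  rw [Set.preimage_inter, hUe, hZe] at hu
  exact Set.mem_iUnion.2 ⟨i, hu⟩

theorem ptTrdeg_le_of_mem_closure_image {K : Type} [Field K] {W W' : Over (SpecK K)}
    [LocallyOfFiniteType W.hom] [QuasiCompact W.hom] [LocallyOfFiniteType W'.hom]
    (f : W ⟶ W') {S : Set W.left} {n : ℕ∞}
    (h : ∀ x ∈ closure S, ptTrdeg x ≤ n) {x : W'.left} (hx : x ∈ closure (f.left '' S)) :
    ptTrdeg x ≤ n := by
  have := noetherianSpace_left W
  obtain ⟨F, hF, hcl, hirr, hF'⟩ :=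
    TopologicalSpace.NoetherianSpace.exists_finite_set_isClosed_irreducible
      (isClosed_closure (s := S))
  have hx' : x ∈ ⋃ t ∈ F, closure (f.left '' t) := by
    rw [← hF.closure_biUnion, ← Set.image_iUnion₂, ← Set.sUnion_eq_biUnion, ← hF']
    exact closure_mono (Set.image_mono subset_closure) hx
  obtain ⟨t, ht, hx⟩ := Set.mem_iUnion₂.1 hx'
  have hη := (hirr t ht).isGenericPoint_genericPoint (hcl t ht)
  have hsp : f.left (hirr t ht).genericPoint ⤳ x := by
    rw [specializes_iff_mem_closure]
    refine closure_minimal ?_ isClosed_closure hx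
    rintro _ ⟨y, hy, rfl⟩
    rw [← specializes_iff_mem_closure]
    exact (hη.specializes hy).map f.left.continuous
  refine (ptTrdeg_le_of_specializes hsp).trans ((ptTrdeg_map_le f _).trans (h _ ?_))
  rw [hF']
  exact ⟨t, ht, hη.mem⟩

theorem ev_comp {K : Type} [Field K] {W W' : Over (SpecK K)} (a : Pt K W) (f : W ⟶ W') :
    ev K (a ≫ f) = f.left (ev K a) :=
  rfl

theorem isInducing_ev_ptPow {K : Type} [Field K] (V : Over (SpecK K)) (Ω : Type) [Finite Ω] :
    letI := cfgTop K V Ω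
    IsInducing fun u : Ω → Pt K V => ev K (ptPow K V Ω u) :=
  letI := cfgTop K V Ω
  ⟨rfl⟩

theorem cfgDim_le_of_ptTrdeg_le {K : Type} [Field K] {V : Over (SpecK K)} {Ω : Type} [Finite Ω]
    [LocallyOfFiniteType (pow K V Ω).hom] {D : Set (Ω → Pt K V)} {n : ℕ}
    (h : ∀ x ∈ closure ((fun u => ev K (ptPow K V Ω u)) '' D), ptTrdeg x ≤ n) :
    cfgDim K V Ω D ≤ n := by
  let := cfgTop K V Ω
  refine topologicalKrullDim_le_of_ptTrdeg_le
    ((isInducing_ev_ptPow V Ω).comp .subtypeVal : IsInducing _) (fun x hx => h x ?_)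
  rwa [Set.range_comp, Subtype.range_val] at hx

theorem ptTrdeg_le_cfgDim {K : Type} [Field K] [IsAlgClosed K] {V : Over (SpecK K)} {Ω : Type}
    [Finite Ω] [LocallyOfFiniteType (pow K V Ω).hom] [QuasiCompact (pow K V Ω).hom]
    {D : Set (Ω → Pt K V)} (hD : cfgConstr K V Ω D) {x : (pow K V Ω).left}
    (hx : x ∈ closure ((fun u => ev K (ptPow K V Ω u)) '' D)) :
    (ptTrdeg x : WithBot ℕ∞) ≤ cfgDim K V Ω D := by
  let := cfgTop K V Ω
  exact ptTrdeg_le_of_isConstr (isInducing_ev_ptPow V Ω) (fun _ => exists_ev_ptPow_mem) hD hx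

theorem exists_cfgDim_eq {K : Type} [Field K] {V : Over (SpecK K)} {Ω : Type}
    [Finite Ω] [LocallyOfFiniteType (pow K V Ω).hom] [QuasiCompact (pow K V Ω).hom]
    {D : Set (Ω → Pt K V)} (hD : D.Nonempty) : ∃ n : ℕ, cfgDim K V Ω D = n := by
  let := cfgTop K V Ω
  obtain ⟨d, hd⟩ := exists_ptTrdeg_le (pow K V Ω)
  have h : cfgDim K V Ω D ≤ d := cfgDim_le_of_ptTrdeg_le fun x _ => hd x
  have : Nonempty (TopologicalSpace.IrreducibleCloseds D) :=
    have := hD.to_subtype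
    ⟨⟨irreducibleComponent (Classical.arbitrary D), isIrreducible_irreducibleComponent,
      isClosed_irreducibleComponent⟩⟩
  have h0 : 0 ≤ cfgDim K V Ω D := Order.krullDim_nonneg
  generalize cfgDim K V Ω D = a at h h0
  induction a with
  | bot => simp at h0
  | coe a =>
    have h' : a ≤ d := by exact_mod_cast h
    refine ⟨a.toNat, ?_⟩
    nth_rw 1 [← ENat.natCast_toNat (ne_top_of_le_ne_top (ENat.natCast_ne_top d) h')]
    rfl

theorem cfgDim_restr_image_le {G : Type} [Group G] {K : Type} [Field K] [IsAlgClosed K]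
    {V : Over (SpecK K)} [LocallyOfFiniteType V.hom] [QuasiCompact V.hom]
    {d : ℕ} (hd : ∀ x : V.left, ptTrdeg x ≤ d) {τ : (G → Pt K V) → (G → Pt K V)}
    {M : Finset G} {f : pow K V M ⟶ V}
    (hτ : ∀ (x : G → Pt K V) (g : G), τ x g = ptPow K V M (fun m => x (g * (m : G))) ≫ f)
    {Γ : Set (G → Pt K V)} {F E : Finset G} (hFE : F ⊆ E) (hE : ∀ g ∈ F, ∀ m ∈ M, g * m ∈ E)
    {T : Finset G} (hT : ∀ g ∈ E, g ∈ F ∨ g ∈ T)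
    (hconstr : cfgConstr K V F (restr K V Γ F)) {n : ℕ} (hn : cfgDim K V F (restr K V Γ F) ≤ n) :
    cfgDim K V F (restr K V (τ '' Γ) F) ≤ (n + T.card * d : ℕ) := by
  have hft (Ω : Finset G) : LocallyOfFiniteType (pow K V Ω).hom :=
    property_pow_hom @LocallyOfFiniteType ‹_› Ω
  have hqc (Ω : Finset G) : QuasiCompact (pow K V Ω).hom := property_pow_hom @QuasiCompact ‹_› Ω
  let e (Ω : Finset G) (u : Ω → Pt K V) : (pow K V Ω).left := ev K (ptPow K V Ω u)
  let π : pow K V E ⟶ pow K V F := powLift fun ω => powπ V ⟨ω, hFE ω.2⟩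
  let φ : pow K V E ⟶ pow K V F :=
    powLift fun ω => powLift (fun m : M => powπ V ⟨ω * m, hE ω ω.2 m m.2⟩) ≫ f
  have hπ (c : G → Pt K V) : π.left (e E fun ω => c ω) = e F fun ω => c ω := by
    rw [← ev_comp]
    refine congrArg (ev K) (pow_hom_ext fun ω => ?_)
    simp [π]
  have hφ (c : G → Pt K V) : φ.left (e E fun ω => c ω) = e F fun ω => τ c ω := by
    rw [← ev_comp]
    refine congrArg (ev K) (pow_hom_ext fun ω => ?_)
    rw [Category.assoc, powLift_powπ, ptPow_powπ, hτ, ← Category.assoc]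
    congr 1
    refine pow_hom_ext fun m => ?_
    simp
  refine cfgDim_le_of_ptTrdeg_le fun x hx => ?_
  refine ptTrdeg_le_of_mem_closure_image φ (S := e E '' restr K V Γ E) (fun y hy => ?_)
    (closure_mono ?_ hx)
  · have hπy : π.left y ∈ closure (e F '' restr K V Γ F) := by
      refine closure_mono ?_ (image_closure_subset_closure_image π.left.continuous ⟨y, hy, rfl⟩)
      rintro _ ⟨_, ⟨_, ⟨c, hc, rfl⟩, rfl⟩, rfl⟩
      exact ⟨_, ⟨c, hc, rfl⟩, (hπ c).symm⟩
    have h1 : ptTrdeg (π.left y) ≤ n := by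
      have := (ptTrdeg_le_cfgDim hconstr hπy).trans hn
      exact_mod_cast this
    classical
    let T' : Finset E := Finset.univ.filter fun ω => (ω : G) ∈ T
    have h2 := ptTrdeg_pow_le (V := V) (fun ω : F => (⟨ω, hFE ω.2⟩ : E)) T' (fun ω => by
      rcases hT ω ω.2 with h | h
      · exact .inl ⟨⟨ω, h⟩, rfl⟩
      · exact .inr (by simp [T', h])) y
    have h3 : T'.card ≤ T.card :=
      Finset.card_le_card_of_injOn Subtype.val (fun ω hω => (Finset.mem_filter.1 hω).2)
        Subtype.val_injective.injOn
    have h4 : ∑ ω ∈ T', ptTrdeg ((powπ V ω).left y) ≤ (T.card * d : ℕ) := by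
      refine (Finset.sum_le_card_nsmul _ _ _ fun ω _ => hd _).trans ?_
      rw [nsmul_eq_mul]
      exact_mod_cast Nat.mul_le_mul_right d h3
    rw [Nat.cast_add]
    exact h2.trans (add_le_add h1 h4)
  · rintro _ ⟨_, ⟨_, ⟨c, hc, rfl⟩, rfl⟩, rfl⟩
    exact ⟨_, ⟨_, ⟨c, hc, rfl⟩, rfl⟩, hφ c⟩

theorem dimE_natCast (n : ℕ) : dimE (n : WithBot ℕ∞) = ((n : ℝ) : EReal) := by
  change (((n : ℕ∞) : ℝ≥0∞) : EReal) = _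
  rw [ENat.toENNReal_coe]
  norm_cast

theorem dimE_le_natCast {a : WithBot ℕ∞} {n : ℕ} (h : a ≤ n) : dimE a ≤ ((n : ℝ) : EReal) := by
  rw [← dimE_natCast]
  induction a with
  | bot => exact bot_le
  | coe a =>
    have h' : a ≤ n := by exact_mod_cast h
    exact EReal.coe_ennreal_le_coe_ennreal_iff.2 (ENat.toENNReal_mono h')

theorem card_biUnion_image_sdiff_le {G : Type} [Group G] [DecidableEq G] (F M : Finset G) :
    (M.biUnion fun m => F.image (· * m) \ F).card ≤
      ∑ m ∈ M, ((F : Set G) \ ((· * m) '' (F : Set G))).ncard := by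
  refine Finset.card_biUnion_le.trans (Finset.sum_le_sum fun m _ => ?_)
  rw [← Finset.coe_image, ← Finset.coe_sdiff, Set.ncard_coe_finset]
  refine (Finset.card_sdiff_comm ?_).le
  exact Finset.card_image_of_injective _ (mul_left_injective m)

/-- Proposition 5.1. Let `G` be an amenable group with a Følner net
`𝓕`, `X` an algebraic variety over an algebraically closed field `K`, `A := X(K)`, and
`τ` an algebraic cellular automaton over `(G,X,K)`. If `Γ ⊆ A^G` has all restrictions
`Γ_Ω` constructible, then `mdim_𝓕(τ(Γ)) ≤ mdim_𝓕(Γ)`. -/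
theorem mdim_image_le
    (G : Type) [Group G] (𝓕 : FolnerNet G)
    (K : Type) [Field K] [IsAlgClosed K]
    (V : Over (SpecK K)) (hft : LocallyOfFiniteType V.hom) (hqc : QuasiCompact V.hom)
    (τ : (G → Pt K V) → (G → Pt K V)) (hca : IsAlgCA K V τ)
    (Γ : Set (G → Pt K V))
    (hconstr : ∀ Ω : Finset G, cfgConstr K V ↥Ω (restr K V Γ Ω)) :
    mdim K V 𝓕 (τ '' Γ) ≤ mdim K V 𝓕 Γ := by
  classical
  obtain rfl | hΓ := Γ.eq_empty_or_nonempty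
  · rw [Set.image_empty]
  obtain ⟨M, f, hτ⟩ := hca
  obtain ⟨d, hd⟩ := exists_ptTrdeg_le V
  let ε (i : 𝓕.ι) : ℝ := d * ∑ m ∈ M,
    (((𝓕.F i : Set G) \ ((· * m) '' (𝓕.F i : Set G))).ncard : ℝ) / ((𝓕.F i).card : ℝ)
  have hε : Tendsto (fun i => (ε i : EReal)) atTop (𝓝 0) := by
    have h := (tendsto_finsetSum M fun m _ => 𝓕.folner m).const_mul (d : ℝ)
    rw [Finset.sum_const_zero, mul_zero] at h
    exact (continuous_coe_real_ereal.tendsto 0).comp h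
  have key (i : 𝓕.ι) : dimE (cfgDim K V (𝓕.F i) (restr K V (τ '' Γ) (𝓕.F i))) *
        ((((𝓕.F i).card : ℝ)⁻¹ : ℝ) : EReal) ≤
      dimE (cfgDim K V (𝓕.F i) (restr K V Γ (𝓕.F i))) * ((((𝓕.F i).card : ℝ)⁻¹ : ℝ) : EReal) +
        (ε i : EReal) := by
    set F := 𝓕.F i with hF
    have hft' : LocallyOfFiniteType (pow K V F).hom := property_pow_hom @LocallyOfFiniteType hft F
    have hqc' : QuasiCompact (pow K V F).hom := property_pow_hom @QuasiCompact hqc F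
    obtain ⟨n, hn⟩ := exists_cfgDim_eq (hΓ.image fun c (ω : F) => c ω)
    have hn' : cfgDim K V F (restr K V Γ F) = n := hn
    let T := M.biUnion fun m => F.image (· * m) \ F
    have h := dimE_le_natCast (cfgDim_restr_image_le hd hτ (F := F) (E := F ∪ T) (T := T)
      Finset.subset_union_left
      (fun g hg m hm => by
        simp only [T, Finset.mem_union, Finset.mem_biUnion, Finset.mem_sdiff, Finset.mem_image]
        grind)
      (fun g hg => Finset.mem_union.1 hg) (hconstr F) hn'.le)
    rw [hn', dimE_natCast]
    refine (mul_le_mul_of_nonneg_right h (by positivity)).trans ?_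
    rw [← EReal.coe_mul, ← EReal.coe_mul, ← EReal.coe_add, EReal.coe_le_coe_iff]
    have hT : (T.card : ℝ) ≤
        ∑ m ∈ M, (((F : Set G) \ ((· * m) '' (F : Set G))).ncard : ℝ) := by
      exact_mod_cast card_biUnion_image_sdiff_le F M
    simp only [ε, ← hF, div_eq_mul_inv, ← Finset.sum_mul]
    rw [← mul_assoc, ← add_mul]
    push_cast
    rw [mul_comm (T.card : ℝ)]
    gcongr
  refine (limsup_le_limsup (Eventually.of_forall key)).trans ?_
  refine (EReal.limsup_add_le (.inr ?_) (.inr ?_)).trans ?_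
  · rw [hε.limsup_eq]; exact EReal.zero_ne_top
  · rw [hε.limsup_eq]; exact EReal.bot_ne_zero.symm
  · rw [hε.limsup_eq, add_zero]
    exact le_rfl

end GOE
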